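/- Let 𝒳 be a G-automaton. Then for every state L of the minimization m(𝒳), the language of L computed in m(𝒳) equals L itself, i.e. ⟦L⟧ = L. In particular, ⟦m(𝒳)⟧ = ⟦𝒳⟧. -/

import Mathlib

open scoped Classical

/-- Guarded strings `GS = (At·Σ)*·At`, represented as a pair of a word in
`(At·Σ)*` (the guarded string without terminating atom) and a terminating atom. -/
abbrev GS (At Act : Type*) := List (At × Act) × At

variable {At Act X Y : Type*}

/-- Acceptance of a guarded string by a state of a `G`-coalgebra. -/
def GAccepts (δ : X → At → Bool ⊕ (Act × X)) : X → List (At × Act) → At → Prop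
  | x, [], β => δ x β = Sum.inl true
  | x, (α, p) :: w, β => ∃ y, δ x α = Sum.inr (p, y) ∧ GAccepts δ y w β

/-- The language `⟦x⟧ ⊆ GS` of a state of a `G`-coalgebra. -/
def glang (δ : X → At → Bool ⊕ (Act × X)) (x : X) : Set (GS At Act) :=
  {g | GAccepts δ x g.1 g.2}

/-- The transition relation `x →^w y` of a `G`-coalgebra. -/
inductive GReaches (δ : X → At → Bool ⊕ (Act × X)) : X → List (At × Act) → X → Prop
  | refl (x : X) : GReaches δ x [] x
  | single {x : X} {α : At} {p : Act} {y : X} :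
      δ x α = Sum.inr (p, y) → GReaches δ x [(α, p)] y
  | snoc {x y z : X} {v : List (At × Act)} {α : At} {p : Act} :
      GReaches δ x v y → δ y α = Sum.inr (p, z) → GReaches δ x (v ++ [(α, p)]) z

/-- The set `r(x)` of states reachable from `x`. -/
def grState (δ : X → At → Bool ⊕ (Act × X)) (x : X) : Set X :=
  {y | ∃ w, GReaches δ x w y}

/-- The set `R(x)` of words witnessing reachability from `x`. -/
def gRWords (δ : X → At → Bool ⊕ (Act × X)) (x : X) : Set (List (At × Act)) :=
  {w | ∃ y, GReaches δ x w y}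

/-- A `G`-coalgebra is normal if it only transitions to live states. -/
def GNormal (δ : X → At → Bool ⊕ (Act × X)) : Prop :=
  ∀ x α p y, δ x α = Sum.inr (p, y) → (glang δ y).Nonempty

/-- The derivative `w⁻¹L` of a guarded-string language. -/
def gderiv (w : List (At × Act)) (L : Set (GS At Act)) : Set (GS At Act) :=
  {u | (w ++ u.1, u.2) ∈ L}

/-- The transition map of the minimization `m(𝒳)` (defined on all of `Set GS`). -/
noncomputable def minDelta : Set (GS At Act) → At → Bool ⊕ (Act × Set (GS At Act)) :=
  fun L α =>
    if h : ∃ p : Act, (gderiv [(α, p)] L).Nonempty then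
      Sum.inr (h.choose, gderiv [(α, h.choose)] L)
    else if (([], α) : GS At Act) ∈ L then Sum.inl true
    else Sum.inl false

/-- The state space `{w⁻¹⟦𝒳⟧ | w ∈ R(x)}` of the minimization `m(𝒳)`. -/
def MinStates (δ : X → At → Bool ⊕ (Act × X)) (x : X) : Set (Set (GS At Act)) :=
  {L | ∃ w ∈ gRWords δ x, L = gderiv w (glang δ x)}

/-- Restriction of a `G`-coalgebra to an invariant subset of states. -/
def grestrict (δ : X → At → Bool ⊕ (Act × X)) (A : Set X)
    (hA : ∀ y ∈ A, ∀ (α : At) (p : Act) (z : X), δ y α = Sum.inr (p, z) → z ∈ A) :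
    A → At → Bool ⊕ (Act × A) := fun y α =>
  match h : δ y.val α with
  | Sum.inl b => Sum.inl b
  | Sum.inr (p, z) => Sum.inr (p, ⟨z, hA y.val y.2 α p z h⟩)

/-- Compatibility of two guarded strings: they agree on their first `n` actions
(or lack thereof) whenever they agree on their first `n` atoms. -/
def GCompat : List (At × Act) → At → List (At × Act) → At → Prop
  | [], _, [], _ => True
  | [], β, (α, _) :: _, _ => β ≠ α
  | (α, _) :: _, _, [], β => β ≠ α
  | (α, p) :: u, β, (α', p') :: u', β' => α = α' → p = p' ∧ GCompat u β u' β'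

/-- A guarded-string language is deterministic if any two of its strings that agree
on their first `n` atoms also agree on their first `n` actions (or lack thereof). -/
def GDetLang (L : Set (GS At Act)) : Prop :=
  ∀ u ∈ L, ∀ v ∈ L, GCompat u.1 u.2 v.1 v.2

/-- Bisimulations between `G`-coalgebras. -/
def IsGBisim (δX : X → At → Bool ⊕ (Act × X)) (δY : Y → At → Bool ⊕ (Act × Y))
    (R : X → Y → Prop) : Prop :=
  ∀ x y, R x y → ∀ α : At,
    (∀ b : Bool, δX x α = Sum.inl b → δY y α = Sum.inl b) ∧
    (∀ p x', δX x α = Sum.inr (p, x') → ∃ y', δY y α = Sum.inr (p, y') ∧ R x' y')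

/-- Bisimilarity of states of `G`-coalgebras. -/
def GBisimilar (δX : X → At → Bool ⊕ (Act × X)) (δY : Y → At → Bool ⊕ (Act × Y))
    (x : X) (y : Y) : Prop :=
  ∃ R, IsGBisim δX δY R ∧ R x y

/-- Simulations between `G`-coalgebras. -/
def IsGSim (δX : X → At → Bool ⊕ (Act × X)) (δY : Y → At → Bool ⊕ (Act × Y))
    (R : X → Y → Prop) : Prop :=
  ∀ x y, R x y → ∀ α : At,
    (δX x α = Sum.inl true → δY y α = Sum.inl true) ∧
    (∀ p x', δX x α = Sum.inr (p, x') → ∃ y', δY y α = Sum.inr (p, y') ∧ R x' y')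

/-- Similarity of states of `G`-coalgebras. -/
def GSimilar (δX : X → At → Bool ⊕ (Act × X)) (δY : Y → At → Bool ⊕ (Act × Y))
    (x : X) (y : Y) : Prop :=
  ∃ R, IsGSim δX δY R ∧ R x y

/-- Observation tables for the `GL*` algorithm. -/
structure ObsTable (At Act : Type*) where
  S : Set (List (At × Act))
  E : Set (GS At Act)
  row : List (At × Act) → Set (GS At Act)
  eps_mem : [] ∈ S
  atoms_mem : ∀ α : At, (([], α) : GS At Act) ∈ E
  prefix_closed : ∀ (s : List (At × Act)) (α : At) (p : Act), s ++ [(α, p)] ∈ S → s ∈ S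
  suffix_closed : ∀ (α : At) (p : Act) (e : GS At Act), (((α, p) :: e.1, e.2) : GS At Act) ∈ E → e ∈ E
  row_sub : ∀ t, row t ⊆ E
  rows_distinct : ∀ s ∈ S, ∀ t ∈ S, row s = row t → s = t
  row_nonempty : ∀ s ∈ S, s ≠ [] → (row s).Nonempty
  row_compat : ∀ s ∈ S, ∀ (α : At) (p : Act) (e : GS At Act),
      (((α, p) :: e.1, e.2) : GS At Act) ∈ E →
      (e ∈ row (s ++ [(α, p)]) ↔ (((α, p) :: e.1, e.2) : GS At Act) ∈ row s)

/-- A table is deterministic if all of its upper rows are deterministic languages. -/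
def ObsTable.Det (T : ObsTable At Act) : Prop := ∀ s ∈ T.S, GDetLang (T.row s)

/-- A table is closed if every nonzero lower row equals some upper row. -/
def ObsTable.Closed (T : ObsTable At Act) : Prop :=
  ∀ s ∈ T.S, ∀ (α : At) (p : Act), (T.row (s ++ [(α, p)])).Nonempty →
    ∃ t ∈ T.S, T.row t = T.row (s ++ [(α, p)])

/-- The transition map of the hypothesis automaton `m(T)` (defined on all of `Set GS`). -/
noncomputable def hypDelta (T : ObsTable At Act) :
    Set (GS At Act) → At → Bool ⊕ (Act × Set (GS At Act)) := fun L α =>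
  if h : ∃ s, s ∈ T.S ∧ T.row s = L then
    if hp : ∃ p : Act, (T.row (h.choose ++ [(α, p)])).Nonempty then
      Sum.inr (hp.choose, T.row (h.choose ++ [(α, hp.choose)]))
    else if (([], α) : GS At Act) ∈ L then Sum.inl true
    else Sum.inl false
  else Sum.inl false

/-- The state space `{row(s) | s ∈ S}` of the hypothesis automaton `m(T)`. -/
def HypStates (T : ObsTable At Act) : Set (Set (GS At Act)) := T.row '' T.S

/-- A `G`-automaton `(Y, δY, y)` is consistent with an observation table `T`. -/
def ConsistentWith (T : ObsTable At Act) (δY : Y → At → Bool ⊕ (Act × Y)) (y : Y) : Prop :=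
  T.S ⊆ gRWords δY y ∧
  ∀ s ∈ T.S, ∀ ys, GReaches δY y s ys → ∀ e ∈ T.E, (e ∈ glang δY ys ↔ e ∈ T.row s)

/-- Guarded-string suffixes of a guarded string (auxiliary version). -/
def gsufAux : List (At × Act) → At → Set (GS At Act)
  | [], β => {(([] : List (At × Act)), β)}
  | ap :: w, β => insert ((ap :: w, β) : GS At Act) (gsufAux w β)

/-- The set `suf(z)` of guarded-string suffixes of a guarded string `z`. -/
def gsuf (z : GS At Act) : Set (GS At Act) := gsufAux z.1 z.2

/-- Acceptance for Moore automata with input `At·Σ` and output `2^At`. -/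
def MAccepts (tr : Y → (At × Act) → Y) (out : Y → At → Bool) : Y → List (At × Act) → At → Prop
  | y, [], β => out y β = true
  | y, ap :: w, β => MAccepts tr out (tr y ap) w β

/-- The language of a state of a Moore automaton with input `At·Σ` and output `2^At`. -/
def mlang (tr : Y → (At × Act) → Y) (out : Y → At → Bool) (y : Y) : Set (GS At Act) :=
  {g | MAccepts tr out y g.1 g.2}

/-- Transition map of the Moore automaton `f(𝒳)` obtained from a `G`-automaton
by adding a sink state `⋆` (`= none`). -/
noncomputable def fTrans (δ : X → At → Bool ⊕ (Act × X)) : Option X → (At × Act) → Option X :=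
  fun s ap =>
    match s with
    | none => none
    | some y =>
      match δ y ap.1 with
      | Sum.inl _ => none
      | Sum.inr (q, z) => if q = ap.2 then some z else none

/-- Output map of the Moore automaton `f(𝒳)`. -/
noncomputable def fOut (δ : X → At → Bool ⊕ (Act × X)) : Option X → At → Bool :=
  fun s α =>
    match s with
    | none => false
    | some y => if δ y α = Sum.inl true then true else false

theorem gderiv_append (v w : List (At × Act)) (L : Set (GS At Act)) :
    gderiv (v ++ w) L = gderiv w (gderiv v L) := by
  ext u
  simp [gderiv]

/-- Deriving the language of a state along a transition gives the language of its target. -/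
theorem gderiv_singleton_glang {δ : X → At → Bool ⊕ (Act × X)} {x y : X} {α : At} {p : Act}
    (h : δ x α = Sum.inr (p, y)) : gderiv [(α, p)] (glang δ x) = glang δ y := by
  ext u
  simp [gderiv, glang, GAccepts, h]

theorem GReaches.gderiv_glang {δ : X → At → Bool ⊕ (Act × X)} {x y : X} {w : List (At × Act)}
    (h : GReaches δ x w y) : gderiv w (glang δ x) = glang δ y := by
  induction h with
  | refl => rfl
  | single h => exact gderiv_singleton_glang h
  | snoc _ h ih => rw [gderiv_append, ih, gderiv_singleton_glang h]

theorem exists_of_gderiv_singleton_glang_nonempty {δ : X → At → Bool ⊕ (Act × X)} {x : X}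
    {α : At} {p : Act} (h : (gderiv [(α, p)] (glang δ x)).Nonempty) :
    ∃ y, δ x α = Sum.inr (p, y) := by
  obtain ⟨u, y, hy, -⟩ := h
  exact ⟨y, hy⟩

theorem minDelta_glang_eq_inl_true_iff (δ : X → At → Bool ⊕ (Act × X)) (x : X) (α : At) :
    minDelta (glang δ x) α = Sum.inl true ↔ δ x α = Sum.inl true := by
  unfold minDelta
  split_ifs with h hα
  · obtain ⟨y, hy⟩ := exists_of_gderiv_singleton_glang_nonempty h.choose_spec
    simp [hy]
  · exact iff_of_true rfl hα
  · exact iff_of_false (by simp) hα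

theorem minDelta_glang_of_nonempty {δ : X → At → Bool ⊕ (Act × X)} {x y : X} {α : At} {p : Act}
    (h : δ x α = Sum.inr (p, y)) (hy : (glang δ y).Nonempty) :
    minDelta (glang δ x) α = Sum.inr (p, glang δ y) := by
  have hex : ∃ q : Act, (gderiv [(α, q)] (glang δ x)).Nonempty :=
    ⟨p, by rwa [gderiv_singleton_glang h]⟩
  obtain ⟨z, hz⟩ := exists_of_gderiv_singleton_glang_nonempty hex.choose_spec
  have hp : hex.choose = p := by
    rw [h] at hz
    exact (Prod.mk.inj (Sum.inr.inj hz)).1.symm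
  unfold minDelta
  rw [dif_pos hex, hp, gderiv_singleton_glang h]

theorem exists_of_minDelta_glang_eq_inr {δ : X → At → Bool ⊕ (Act × X)} {x : X} {α : At} {p : Act}
    {L : Set (GS At Act)} (h : minDelta (glang δ x) α = Sum.inr (p, L)) :
    ∃ y, δ x α = Sum.inr (p, y) ∧ L = glang δ y := by
  unfold minDelta at h
  split_ifs at h with hex
  obtain ⟨rfl, rfl⟩ := Prod.mk.inj (Sum.inr.inj h)
  obtain ⟨y, hy⟩ := exists_of_gderiv_singleton_glang_nonempty hex.choose_spec
  exact ⟨y, hy, gderiv_singleton_glang hy⟩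

theorem gAccepts_minDelta_glang_iff (δ : X → At → Bool ⊕ (Act × X)) (x : X)
    (w : List (At × Act)) (β : At) :
    GAccepts minDelta (glang δ x) w β ↔ GAccepts δ x w β := by
  induction w generalizing x with
  | nil => exact minDelta_glang_eq_inl_true_iff δ x β
  | cons a w ih =>
    constructor
    · rintro ⟨L, hL, hw⟩
      obtain ⟨y, hy, rfl⟩ := exists_of_minDelta_glang_eq_inr hL
      exact ⟨y, hy, (ih y).1 hw⟩
    · rintro ⟨y, hy, hw⟩
      exact ⟨glang δ y, minDelta_glang_of_nonempty hy ⟨(w, β), hw⟩, (ih y).2 hw⟩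

theorem glang_minDelta_glang (δ : X → At → Bool ⊕ (Act × X)) (x : X) :
    glang minDelta (glang δ x) = glang δ x :=
  Set.ext fun u => gAccepts_minDelta_glang_iff δ x u.1 u.2

/-- every state `L` of the minimization `m(𝒳)` accepts exactly the language
`L`; in particular `⟦m(𝒳)⟧ = ⟦𝒳⟧`. -/
theorem minimization_lang {At Act : Type*} [Fintype At] [Nonempty At] [Fintype Act] [Nonempty Act] {X : Type*}
    (δ : X → At → Bool ⊕ (Act × X)) (x : X) :
    (∀ L ∈ MinStates δ x, glang minDelta L = L) ∧
    glang minDelta (glang δ x) = glang δ x := by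
  refine ⟨?_, glang_minDelta_glang δ x⟩
  rintro L ⟨w, ⟨y, hy⟩, rfl⟩
  rw [hy.gderiv_glang, glang_minDelta_glang]
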